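/- Conservation of the higher-order energy: for every solution q : ℝ → ℝⁿ of the Euler–Lagrange equations of a k-th order Lagrangian L, the energy function t ↦ Σ_{j=0}^{k−1} ⟨p_q^{(j)}(t), q^{(j+1)}(t)⟩ − L(j_k q(t)) is constant on ℝ. -/

import Mathlib

open RealInnerProductSpace

noncomputable section

/-- The model space ℝⁿ. -/
abbrev E (n : ℕ) := EuclideanSpace ℝ (Fin n)

/-- The `m`-jet of a curve `q : ℝ → ℝⁿ`:  `jet q m t = (q t, q' t, …, q⁽ᵐ⁾ t)`. -/
def jet {n : ℕ} (q : ℝ → E n) (m : ℕ) : ℝ → (Fin (m + 1) → E n) :=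
  fun t i => iteratedDeriv i q t

/-- The partial gradient `∂_j L` of `L : (ℝⁿ)^{k+1} → ℝ` with respect to its `j`-th slot,
characterized by `⟪∂_j L x, v⟫ = DL x (0, …, v, …, 0)` (with `v` in slot `j`). -/
def pgrad {n k : ℕ} (L : (Fin (k + 1) → E n) → ℝ) (j : Fin (k + 1))
    (x : Fin (k + 1) → E n) : E n :=
  gradient (fun v => L (Function.update x j v)) (x j)

/-- The Euler–Lagrange expression of `L` along the curve `q`:
`E_q t = ∑_{j=0}^{k} (−1)^j (d/dt)^j [∂_j L (j_k q s)] t`. -/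
def EL {n k : ℕ} (L : (Fin (k + 1) → E n) → ℝ) (q : ℝ → E n) (t : ℝ) : E n :=
  ∑ j : Fin (k + 1),
    (-1 : ℝ) ^ (j : ℕ) • iteratedDeriv j (fun s => pgrad L j (jet q k s)) t

/-- `q` is a solution of the Euler–Lagrange equations of `L`. -/
def IsELSolution {n k : ℕ} (L : (Fin (k + 1) → E n) → ℝ) (q : ℝ → E n) : Prop :=
  ∀ t : ℝ, EL L q t = 0

/-- The `j`-th Jacobi–Ostrogradski momentum along `q`:
`p_q^{(j)} t = ∑_{l=0}^{k−1−j} (−1)^l (d/dt)^l [∂_{j+l+1} L (j_k q s)] t`. -/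
def mom {n k : ℕ} (L : (Fin (k + 1) → E n) → ℝ) (q : ℝ → E n) (j : Fin k) (t : ℝ) : E n :=
  ∑ l : Fin (k - (j : ℕ)),
    (-1 : ℝ) ^ (l : ℕ) •
      iteratedDeriv l
        (fun s => pgrad L ⟨(j : ℕ) + (l : ℕ) + 1, by
          have h1 := l.isLt; have h2 := j.isLt; omega⟩ (jet q k s)) t

/-- The Hessian of `L` in its last slot, as a (continuous) linear map `ℝⁿ → ℝⁿ`:
`⟪H_L x u, v⟫ = D²L x ((0,…,0,u), (0,…,0,v))`. -/
def hessLast {n k : ℕ} (L : (Fin (k + 1) → E n) → ℝ) (x : Fin (k + 1) → E n) :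
    E n →L[ℝ] E n :=
  fderiv ℝ (fun v => pgrad L (Fin.last k) (Function.update x (Fin.last k) v))
    (x (Fin.last k))

/-- `L` is regular if the Hessian in its last slot is invertible at every point. -/
def Regular {n k : ℕ} (L : (Fin (k + 1) → E n) → ℝ) : Prop :=
  ∀ x : Fin (k + 1) → E n, Function.Bijective (hessLast L x)

/-- `G : (ℝⁿ)^{2k} → ℝ` is a constant of motion of `L`. -/
def IsConstantOfMotion {n k : ℕ} (L : (Fin (k + 1) → E n) → ℝ)
    (G : (Fin (2 * k - 1 + 1) → E n) → ℝ) : Prop :=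
  ∀ q : ℝ → E n, ContDiff ℝ (⊤ : ℕ∞) q → IsELSolution L q →
    ∃ c : ℝ, ∀ t : ℝ, G (jet q (2 * k - 1) t) = c

section Ostrogradski

variable {F : Type*} [NormedAddCommGroup F] [InnerProductSpace ℝ F]

/-- The alternating sum `∑_{l=0}^{k-j} (−1)^l (d/dt)^l G_{j+l}` attached to a sequence of curves
`G`.  For `G_j = ∂_j L (j_k q)` it is the Euler–Lagrange expression when `j = 0`, and the
momentum `p^{(j-1)}` when `1 ≤ j ≤ k`. -/
def altDerivSum (G : ℕ → ℝ → F) (k j : ℕ) (t : ℝ) : F :=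
  ∑ l ∈ Finset.range (k + 1 - j), (-1 : ℝ) ^ l • iteratedDeriv l (G (j + l)) t

lemma hasDerivAt_iteratedDeriv {f : ℝ → F} (hf : ContDiff ℝ (⊤ : ℕ∞) f) (m : ℕ) (t : ℝ) :
    HasDerivAt (iteratedDeriv m f) (iteratedDeriv (m + 1) f t) t := by
  rw [iteratedDeriv_succ]
  exact (hf.differentiable_iteratedDeriv m
    (by exact_mod_cast WithTop.coe_lt_top m) t).hasDerivAt

lemma altDerivSum_self (G : ℕ → ℝ → F) (k : ℕ) (t : ℝ) : altDerivSum G k k t = G k t := by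
  simp [altDerivSum]

lemma hasDerivAt_altDerivSum_succ {G : ℕ → ℝ → F} (hG : ∀ m, ContDiff ℝ (⊤ : ℕ∞) (G m))
    {k j : ℕ} (hj : j ≤ k) (t : ℝ) :
    HasDerivAt (altDerivSum G k (j + 1)) (G j t - altDerivSum G k j t) t := by
  have h : HasDerivAt (altDerivSum G k (j + 1))
      (∑ l ∈ Finset.range (k - j),
        (-1 : ℝ) ^ l • iteratedDeriv (l + 1) (G (j + 1 + l)) t) t := by
    unfold altDerivSum
    rw [Nat.add_sub_add_right]
    exact HasDerivAt.fun_sum fun l _ =>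
      (hasDerivAt_iteratedDeriv (hG _) l t).const_smul _
  convert h using 1
  rw [altDerivSum, Nat.succ_sub hj, Finset.sum_range_succ']
  simp [pow_succ, add_assoc, add_comm 1]

lemma hasDerivAt_sum_inner_altDerivSum {G : ℕ → ℝ → F} (hG : ∀ m, ContDiff ℝ (⊤ : ℕ∞) (G m))
    {q : ℝ → F} (hq : ContDiff ℝ (⊤ : ℕ∞) q) {k : ℕ} {t : ℝ} (h0 : altDerivSum G k 0 t = 0) :
    HasDerivAt
      (fun s => ∑ j ∈ Finset.range k, ⟪altDerivSum G k (j + 1) s, iteratedDeriv (j + 1) q s⟫)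
      (∑ j ∈ Finset.range (k + 1), ⟪G j t, iteratedDeriv (j + 1) q t⟫) t := by
  have h := HasDerivAt.fun_sum (u := Finset.range k) fun j hj =>
    (hasDerivAt_altDerivSum_succ hG (Finset.mem_range.1 hj).le t).inner ℝ
      (hasDerivAt_iteratedDeriv hq (j + 1) t)
  refine h.congr_deriv ?_
  have hsum := Finset.sum_range_sub
    (fun j => ⟪altDerivSum G k j t, iteratedDeriv (j + 1) q t⟫) k
  rw [h0, inner_zero_left, altDerivSum_self, sub_zero] at hsum
  rw [Finset.sum_range_succ _ k, ← hsum, ← Finset.sum_add_distrib]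
  refine Finset.sum_congr rfl fun j _ => ?_
  rw [inner_sub_left]
  ring

end Ostrogradski

lemma pgrad_eq {n k : ℕ} {L : (Fin (k + 1) → E n) → ℝ} (hL : Differentiable ℝ L)
    (j : Fin (k + 1)) (x : Fin (k + 1) → E n) :
    pgrad L j x = (InnerProductSpace.toDual ℝ (E n)).symm
      ((fderiv ℝ L x).comp (ContinuousLinearMap.single ℝ (fun _ => E n) j)) := by
  have hu : HasFDerivAt (Function.update x j)
      (ContinuousLinearMap.single ℝ (fun _ => E n) j) (x j) := by
    refine (hasFDerivAt_update (𝕜 := ℝ) x (i := j) (x j)).congr_fderiv ?_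
    refine ContinuousLinearMap.ext fun v => funext fun i => ?_
    by_cases h : i = j
    · subst h; simp
    · simp [h]
  have hL' : HasFDerivAt L (fderiv ℝ L x) (Function.update x j (x j)) := by
    rw [Function.update_eq_self]
    exact (hL x).hasFDerivAt
  rw [pgrad, gradient]
  congr 1
  exact (hL'.comp (x j) hu).fderiv

lemma inner_pgrad {n k : ℕ} {L : (Fin (k + 1) → E n) → ℝ} (hL : Differentiable ℝ L)
    (j : Fin (k + 1)) (x : Fin (k + 1) → E n) (v : E n) :
    ⟪pgrad L j x, v⟫ = fderiv ℝ L x (Pi.single j v) := by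
  rw [pgrad_eq hL, InnerProductSpace.toDual_symm_apply]
  rfl

lemma ContDiff.pgrad {n k : ℕ} {L : (Fin (k + 1) → E n) → ℝ} (hL : ContDiff ℝ (⊤ : ℕ∞) L)
    (j : Fin (k + 1)) : ContDiff ℝ (⊤ : ℕ∞) (pgrad L j) := by
  rw [funext (pgrad_eq (hL.differentiable (by simp)) j)]
  exact (InnerProductSpace.toDual ℝ (E n)).symm.toContinuousLinearEquiv.contDiff.comp
    ((hL.fderiv_right (by simp)).clm_comp contDiff_const)

lemma ContDiff.jet {n : ℕ} {q : ℝ → E n} (hq : ContDiff ℝ (⊤ : ℕ∞) q) (m : ℕ) :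
    ContDiff ℝ (⊤ : ℕ∞) (jet q m) :=
  contDiff_pi.2 fun i => by
    simpa only [_root_.jet, iteratedDeriv_eq_iterate] using hq.iterate_deriv (i : ℕ)

lemma hasDerivAt_comp_jet {n k : ℕ} {L : (Fin (k + 1) → E n) → ℝ} (hL : Differentiable ℝ L)
    {q : ℝ → E n} (hq : ContDiff ℝ (⊤ : ℕ∞) q) (t : ℝ) :
    HasDerivAt (fun s => L (jet q k s))
      (∑ j : Fin (k + 1), ⟪pgrad L j (jet q k t), iteratedDeriv ((j : ℕ) + 1) q t⟫) t := by
  have hjet : HasDerivAt (jet q k) (fun i => iteratedDeriv ((i : ℕ) + 1) q t) t :=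
    hasDerivAt_pi.2 fun i => hasDerivAt_iteratedDeriv hq i t
  refine ((hL (jet q k t)).hasFDerivAt.comp_hasDerivAt t hjet).congr_deriv ?_
  simp_rw [inner_pgrad hL]
  rw [← map_sum, Finset.univ_sum_single fun i : Fin (k + 1) => iteratedDeriv ((i : ℕ) + 1) q t]

/-- The curves `s ↦ ∂_m L (j_k q s)`, extended by zero to all indices `m`. -/
def pgradCurve {n k : ℕ} (L : (Fin (k + 1) → E n) → ℝ) (q : ℝ → E n) (m : ℕ) (s : ℝ) : E n :=
  if h : m < k + 1 then pgrad L ⟨m, h⟩ (jet q k s) else 0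

lemma pgradCurve_of_lt {n k : ℕ} (L : (Fin (k + 1) → E n) → ℝ) (q : ℝ → E n) {m : ℕ}
    (h : m < k + 1) : pgradCurve L q m = fun s => pgrad L ⟨m, h⟩ (jet q k s) := by
  funext s
  exact dif_pos h

lemma contDiff_pgradCurve {n k : ℕ} {L : (Fin (k + 1) → E n) → ℝ}
    (hL : ContDiff ℝ (⊤ : ℕ∞) L) {q : ℝ → E n} (hq : ContDiff ℝ (⊤ : ℕ∞) q) (m : ℕ) :
    ContDiff ℝ (⊤ : ℕ∞) (pgradCurve L q m) := by
  by_cases h : m < k + 1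
  · rw [pgradCurve_of_lt L q h]
    exact (hL.pgrad _).comp (hq.jet k)
  · have : pgradCurve L q m = fun _ => 0 := funext fun s => dif_neg h
    rw [this]
    exact contDiff_const

lemma EL_eq_altDerivSum {n k : ℕ} (L : (Fin (k + 1) → E n) → ℝ) (q : ℝ → E n) (t : ℝ) :
    EL L q t = altDerivSum (pgradCurve L q) k 0 t := by
  rw [EL, altDerivSum, Nat.sub_zero, Finset.sum_range]
  refine Finset.sum_congr rfl fun j _ => ?_
  rw [Nat.zero_add, pgradCurve_of_lt L q j.isLt]

lemma mom_eq_altDerivSum {n k : ℕ} (L : (Fin (k + 1) → E n) → ℝ) (q : ℝ → E n) (j : Fin k)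
    (t : ℝ) : mom L q j t = altDerivSum (pgradCurve L q) k (j + 1) t := by
  rw [mom, altDerivSum, Nat.add_sub_add_right, Finset.sum_range]
  refine Finset.sum_congr rfl fun l _ => ?_
  rw [pgradCurve_of_lt L q (by omega)]
  simp only [Nat.add_right_comm]

/-- **Conservation of the higher-order energy.**
For every solution `q` of the Euler–Lagrange equations of a `k`-th order Lagrangian `L`,
the energy `t ↦ ∑_{j=0}^{k−1} ⟪p_q^{(j)} t, q^{(j+1)} t⟫ − L (j_k q t)` is constant on `ℝ`. -/
theorem energy_conservation
    (n k : ℕ) (hn : 1 ≤ n) (hk : 1 ≤ k)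
    (L : (Fin (k + 1) → E n) → ℝ) (hL : ContDiff ℝ (⊤ : ℕ∞) L)
    (q : ℝ → E n) (hq : ContDiff ℝ (⊤ : ℕ∞) q) (hsol : IsELSolution L q) :
    ∃ c : ℝ, ∀ t : ℝ,
      (∑ j : Fin k, ⟪mom L q j t, iteratedDeriv ((j : ℕ) + 1) q t⟫) -
        L (jet q k t) = c := by
  have hderiv : ∀ t, HasDerivAt (fun s =>
      (∑ j : Fin k, ⟪mom L q j s, iteratedDeriv ((j : ℕ) + 1) q s⟫) - L (jet q k s)) 0 t := by
    intro t
    have h0 : altDerivSum (pgradCurve L q) k 0 t = 0 := by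
      rw [← EL_eq_altDerivSum, hsol t]
    have h := (hasDerivAt_sum_inner_altDerivSum (contDiff_pgradCurve hL hq) hq h0).sub
      (hasDerivAt_comp_jet (hL.differentiable (by simp)) hq t)
    simp only [mom_eq_altDerivSum]
    simp only [Finset.sum_range] at h
    refine h.congr_deriv (sub_eq_zero.2 (Finset.sum_congr rfl fun j _ => ?_))
    rw [pgradCurve_of_lt L q j.isLt]
  exact ⟨_, fun t => is_const_of_deriv_eq_zero (fun s => (hderiv s).differentiableAt)
    (fun s => (hderiv s).deriv) t 0⟩
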